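/- Let (R,𝔪) be a Noetherian local ring, M a finitely generated R-module of finiteness dimension t > 0, and n_0 ≥ 1 with 𝔪^{n_0} H^i_𝔪(M) = 0 for all i < t. Let x_1,…,x_t be a filter regular sequence on M contained in 𝔪^{2n_0}. Then for all 1 ≤ k ≤ n_0 and 0 ≤ j ≤ t there is an isomorphism Hom_R(R/𝔪^k, M/(x_1,…,x_j)M) ≅ ⊕_{i=0}^{j} Hom_R(R/𝔪^k, H^i_𝔪(M))^{⊕ C(j,i)}, where C(j,i) is the binomial coefficient. -/

import Mathlib

universe u

open IsLocalRing

/-- The `i`-th local cohomology module `H^i_J(M)`. -/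
noncomputable def lcoh {R : Type u} [CommRing R] (J : Ideal R) (i : ℕ)
    (M : Type u) [AddCommGroup M] [Module R M] : ModuleCat.{u} R :=
  (localCohomology J i).obj (ModuleCat.of R M)

/-- `x` is a filter regular sequence on `M`. -/
def IsFilterRegularSeq {R : Type u} [CommRing R] (𝔪 : Ideal R)
    (M : Type u) [AddCommGroup M] [Module R M] {s : ℕ} (x : Fin s → R) : Prop :=
  ∀ i : Fin s, ∀ m : M,
    x i • m ∈ (Ideal.span (x '' {j | j < i}) • ⊤ : Submodule R M) →
      ∃ n : ℕ, ∀ r ∈ 𝔪 ^ n, r • m ∈ (Ideal.span (x '' {j | j < i}) • ⊤ : Submodule R M)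

section
set_option linter.unusedSimpArgs false
open CategoryTheory

namespace LCH
noncomputable section
variable {R : Type u} [CommRing R] (I : Ideal R)

abbrev Xq (n : ℕ) : ModuleCat.{u} R := ModuleCat.of R (R ⧸ I ^ n)

def pq {n m : ℕ} (h : n ≤ m) : Xq I m ⟶ Xq I n :=
  ModuleCat.ofHom (Submodule.mapQ _ _ LinearMap.id (Ideal.pow_le_pow_right h))

lemma pq_refl (n : ℕ) : pq I (le_refl n) = 𝟙 _ := by
  ext; rfl

lemma pq_comp {n m k : ℕ} (h : n ≤ m) (h' : m ≤ k) : pq I h' ≫ pq I h = pq I (h.trans h') := by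
  ext; rfl

def tr (i : ℕ) (M : ModuleCat.{u} R) (n m : ℕ) (h : n ≤ m) :
    Abelian.Ext (Xq I n) M i →ₗ[R] Abelian.Ext (Xq I m) M i :=
  Abelian.Ext.precompOfLinear (Abelian.Ext.mk₀ (pq I h)) R M (zero_add i)

lemma tr_apply (i : ℕ) (M : ModuleCat.{u} R) (n m : ℕ) (h : n ≤ m) (x : Abelian.Ext (Xq I n) M i) :
    tr I i M n m h x = (Abelian.Ext.mk₀ (pq I h)).comp x (zero_add i) := rfl

instance (i : ℕ) (M : ModuleCat.{u} R) :
    DirectedSystem (fun n => Abelian.Ext (Xq I n) M i) (fun n m h => tr I i M n m h) where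
  map_self n x := by
    rw [tr_apply, pq_refl, Abelian.Ext.mk₀_id_comp]
  map_map k j i h h' x := by
    rw [tr_apply, tr_apply, tr_apply, Abelian.Ext.mk₀_comp_mk₀_assoc, pq_comp]

abbrev T0 (i : ℕ) (M : ModuleCat.{u} R) : Type u :=
  Module.DirectLimit (fun n => Abelian.Ext (Xq I n) M i) (tr I i M)

/-- local cohomology via the derived-category Ext -/
def T (i : ℕ) (M : ModuleCat.{u} R) : Type u := T0 I i M

instance (i : ℕ) (M : ModuleCat.{u} R) : AddCommGroup (T I i M) :=
  Module.DirectLimit.addCommGroup _ (tr I i M)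

instance (i : ℕ) (M : ModuleCat.{u} R) : Module R (T I i M) :=
  Module.DirectLimit.module _ (tr I i M)

def ofT (i : ℕ) (M : ModuleCat.{u} R) (n : ℕ) : Abelian.Ext (Xq I n) M i →ₗ[R] T I i M :=
  Module.DirectLimit.of R ℕ (fun n => Abelian.Ext (Xq I n) M i) (tr I i M) n

lemma exists_of {i : ℕ} {M : ModuleCat.{u} R} (t : T I i M) : ∃ n x, ofT I i M n x = t := by
  exact Module.DirectLimit.exists_of (f := tr I i M) t

lemma of_zero {i : ℕ} {M : ModuleCat.{u} R} {n : ℕ} (x : Abelian.Ext (Xq I n) M i)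
    (hx : ofT I i M n x = 0) : ∃ m, ∃ h : n ≤ m, tr I i M n m h x = 0 := by
  exact Module.DirectLimit.of.zero_exact (f := tr I i M) hx

lemma of_tr {i : ℕ} {M : ModuleCat.{u} R} {n m : ℕ} (h : n ≤ m) (x : Abelian.Ext (Xq I n) M i) :
    ofT I i M m (tr I i M n m h x) = ofT I i M n x := by
  exact Module.DirectLimit.of_f (f := tr I i M)

def liftT {i : ℕ} {M : ModuleCat.{u} R} {P : Type u} [AddCommGroup P] [Module R P]
    (g : ∀ n, Abelian.Ext (Xq I n) M i →ₗ[R] P)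
    (hg : ∀ n m h x, g m (tr I i M n m h x) = g n x) : T I i M →ₗ[R] P :=
  Module.DirectLimit.lift R ℕ (fun n => Abelian.Ext (Xq I n) M i) (tr I i M) g hg

lemma liftT_of {i : ℕ} {M : ModuleCat.{u} R} {P : Type u} [AddCommGroup P] [Module R P]
    (g : ∀ n, Abelian.Ext (Xq I n) M i →ₗ[R] P)
    (hg : ∀ n m h x, g m (tr I i M n m h x) = g n x) (n : ℕ) (x : Abelian.Ext (Xq I n) M i) :
    liftT I g hg (ofT I i M n x) = g n x :=
  Module.DirectLimit.lift_of (f := tr I i M) g hg x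

lemma tr_comp {M N : ModuleCat.{u} R} {a : ℕ} (β : Abelian.Ext M N a) {i b : ℕ} (h : i + a = b)
    {n m : ℕ} (hnm : n ≤ m) (x : Abelian.Ext (Xq I n) M i) :
    (tr I i M n m hnm x).comp β h = tr I b N n m hnm (x.comp β h) := by
  rw [tr_apply, tr_apply, Abelian.Ext.comp_assoc _ _ _ (zero_add i) h (by omega)]

def post {M N : ModuleCat.{u} R} {a : ℕ} (β : Abelian.Ext M N a) {i b : ℕ} (h : i + a = b) :
    T I i M →ₗ[R] T I b N :=
  liftT I (fun n => ofT I b N n ∘ₗ Abelian.Ext.postcompOfLinear β R (Xq I n) h) (by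
    intro n m hnm x
    change ofT I b N m ((tr I i M n m hnm x).comp β h) = ofT I b N n (x.comp β h)
    rw [tr_comp, of_tr])

lemma post_of {M N : ModuleCat.{u} R} {a : ℕ} (β : Abelian.Ext M N a) {i b : ℕ}
    (h : i + a = b) (n : ℕ) (x : Abelian.Ext (Xq I n) M i) :
    post I β h (ofT I i M n x) = ofT I b N n (x.comp β h) :=
  liftT_of ..

lemma post_exact {M N L : ModuleCat.{u} R} {a a' : ℕ} (β : Abelian.Ext M N a) {i b c : ℕ}
    (h : i + a = b) (γ : Abelian.Ext L M a') (h' : c + a' = i)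
    (H : ∀ X (x : Abelian.Ext X M i), x.comp β h = 0 → ∃ y : Abelian.Ext X L c, y.comp γ h' = x)
    (t : T I i M) (ht : post I β h t = 0) : ∃ s, post I γ h' s = t := by
  obtain ⟨n, x, rfl⟩ := exists_of I t
  rw [post_of] at ht
  obtain ⟨m, hm, hx⟩ := of_zero I _ ht
  rw [← tr_comp] at hx
  obtain ⟨y, hy⟩ := H _ _ hx
  refine ⟨ofT I c L m y, ?_⟩
  rw [post_of, hy, of_tr]

lemma post_post {M N L : ModuleCat.{u} R} {a a' : ℕ} (β : Abelian.Ext M N a) {i b c : ℕ}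
    (h : i + a = b) (γ : Abelian.Ext N L a') (h' : b + a' = c) (t : T I i M) {d : ℕ}
    (hd : a + a' = d) :
    post I γ h' (post I β h t) = post I (β.comp γ hd) (show i + d = c by omega) t := by
  obtain ⟨n, x, rfl⟩ := exists_of I t
  simp only [post_of]
  rw [Abelian.Ext.comp_assoc _ _ _ h hd (by omega)]

def Tm (i : ℕ) {M N : ModuleCat.{u} R} (f : M ⟶ N) : T I i M →ₗ[R] T I i N :=
  post I (Abelian.Ext.mk₀ f) (add_zero i)

lemma Tm_comp (i : ℕ) {M N L : ModuleCat.{u} R} (f : M ⟶ N) (g : N ⟶ L) (t : T I i M) :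
    Tm I i g (Tm I i f t) = Tm I i (f ≫ g) t := by
  unfold Tm
  rw [post_post I _ _ _ _ _ (add_zero 0)]
  simp

lemma Tm_id (i : ℕ) {M : ModuleCat.{u} R} (t : T I i M) : Tm I i (𝟙 M) t = t := by
  obtain ⟨n, x, rfl⟩ := exists_of I t
  simp [Tm, post_of, Abelian.Ext.mk₀_add, Abelian.Ext.mk₀_smul]

lemma Tm_zero (i : ℕ) {M N : ModuleCat.{u} R} (t : T I i M) : Tm I i (0 : M ⟶ N) t = 0 := by
  obtain ⟨n, x, rfl⟩ := exists_of I t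
  simp [Tm, post_of, Abelian.Ext.mk₀_add, Abelian.Ext.mk₀_smul]

lemma Tm_add (i : ℕ) {M N : ModuleCat.{u} R} (f g : M ⟶ N) (t : T I i M) :
    Tm I i (f + g) t = Tm I i f t + Tm I i g t := by
  obtain ⟨n, x, rfl⟩ := exists_of I t
  simp [Tm, post_of, Abelian.Ext.mk₀_add, Abelian.Ext.mk₀_smul]

lemma Tm_sum (i : ℕ) {M N : ModuleCat.{u} R} {ι : Type*} (s : Finset ι) (f : ι → (M ⟶ N))
    (t : T I i M) : Tm I i (∑ l ∈ s, f l) t = ∑ l ∈ s, Tm I i (f l) t := by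
  classical
  induction s using Finset.induction_on with
  | empty => simp [Tm_zero]
  | insert a s ha ih => rw [Finset.sum_insert ha, Finset.sum_insert ha, Tm_add, ih]

lemma Tm_smul (i : ℕ) {M N : ModuleCat.{u} R} (r : R) (f : M ⟶ N) (t : T I i M) :
    Tm I i (r • f) t = r • Tm I i f t := by
  obtain ⟨n, x, rfl⟩ := exists_of I t
  simp [Tm, post_of, Abelian.Ext.mk₀_add, Abelian.Ext.mk₀_smul]

lemma exact2 {S : ShortComplex (ModuleCat.{u} R)} (hS : S.ShortExact) (i : ℕ) (t : T I i S.X₂) (ht : Tm I i S.g t = 0) : ∃ s, Tm I i S.f s = t :=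
  post_exact I _ _ _ _ (fun X x hx => Abelian.Ext.covariant_sequence_exact₂ X hS x hx) t ht

section les
variable {S : ShortComplex (ModuleCat.{u} R)} (hS : S.ShortExact)

def dl (i : ℕ) : T I i S.X₃ →ₗ[R] T I (i+1) S.X₁ := post I hS.extClass rfl

lemma exact3 (i : ℕ) (t : T I i S.X₃) (ht : dl I hS i t = 0) : ∃ s, Tm I i S.g s = t :=
  post_exact I _ _ _ _ (fun X x hx => Abelian.Ext.covariant_sequence_exact₃ X hS x _ hx) t ht

lemma exact1 (i : ℕ) (t : T I (i+1) S.X₁) (ht : Tm I (i+1) S.f t = 0) : ∃ s, dl I hS i s = t :=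
  post_exact I _ _ _ _ (fun X x hx => Abelian.Ext.covariant_sequence_exact₁ X hS x hx _) t ht

lemma exact0 (t : T I 0 S.X₁) (ht : Tm I 0 S.f t = 0) (hS : S.ShortExact) : t = 0 := by
  obtain ⟨n, x, rfl⟩ := exists_of I t
  rw [Tm, post_of] at ht
  obtain ⟨m, hm, hx⟩ := of_zero I _ ht
  rw [← tr_comp] at hx
  have := hS.mono_f
  have h2 := Abelian.Ext.postcomp_mk₀_injective_of_mono (Xq I m) S.f
    (a₁ := tr I 0 _ n m hm x) (a₂ := 0) (by simpa using! hx)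
  rw [← of_tr I hm, h2, map_zero]

lemma dl_comp (i : ℕ) (t : T I i S.X₂) : dl I hS i (Tm I i S.g t) = 0 := by
  obtain ⟨n, x, rfl⟩ := exists_of I t
  rw [Tm, dl, post_of, post_of, Abelian.Ext.comp_assoc _ _ _ (add_zero i) (zero_add 1) (by omega)]
  simp

lemma comp_dl (i : ℕ) (t : T I i S.X₃) : Tm I (i+1) S.f (dl I hS i t) = 0 := by
  obtain ⟨n, x, rfl⟩ := exists_of I t
  rw [Tm, dl, post_of, post_of, Abelian.Ext.comp_assoc _ _ _ rfl (add_zero 1) (by omega)]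
  simp

lemma dl_nat {S' : ShortComplex (ModuleCat.{u} R)} (hS' : S'.ShortExact) (f : S ⟶ S') (i : ℕ)
    (t : T I i S.X₃) : dl I hS' i (Tm I i f.τ₃ t) = Tm I (i+1) f.τ₁ (dl I hS i t) := by
  obtain ⟨n, x, rfl⟩ := exists_of I t
  rw [Tm, Tm, dl, dl, post_of, post_of, post_of, post_of,
    Abelian.Ext.comp_assoc _ _ _ (add_zero i) (zero_add 1) (by omega),
    Abelian.Ext.comp_assoc _ _ _ rfl (add_zero 1) (by omega),
    ShortComplex.ShortExact.extClass_naturality]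

end les
lemma T_inj (i : ℕ) (E : ModuleCat.{u} R) [Injective E] (t : T I (i+1) E) : t = 0 := by
  obtain ⟨n, x, rfl⟩ := exists_of I t
  rw [Abelian.Ext.eq_zero_of_injective x, map_zero]

end
end LCH
end

section
open CategoryTheory
namespace LCH
noncomputable section
variable {R : Type u} [CommRing R] (I : Ideal R)

def evn (M : ModuleCat.{u} R) (n : ℕ) : Abelian.Ext (Xq I n) M 0 →ₗ[R] M where
  toFun x := (Abelian.Ext.linearEquiv₀ (R := R) x).hom (1 : R ⧸ I ^ n)
  map_add' x y := by simp
  map_smul' r x := by simp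

lemma evn_mk (M : ModuleCat.{u} R) (n : ℕ) (f : Xq I n ⟶ M) :
    evn I M n (Abelian.Ext.mk₀ f) = f.hom (1 : R ⧸ I ^ n) := by
  change (Abelian.Ext.linearEquiv₀ (R := R) (Abelian.Ext.mk₀ f)).hom _ = _
  rw [← Abelian.Ext.linearEquiv₀_symm_apply (R := R), LinearEquiv.apply_symm_apply]

def ev (M : ModuleCat.{u} R) : T I 0 M →ₗ[R] M :=
  liftT I (evn I M) (by
    intro n m h x
    obtain ⟨f, rfl⟩ := (Abelian.Ext.mk₀_bijective _ _).2 x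
    rw [tr_apply, Abelian.Ext.mk₀_comp_mk₀, evn_mk, evn_mk]
    rfl)

lemma ev_mk (M : ModuleCat.{u} R) (n : ℕ) (f : Xq I n ⟶ M) :
    ev I M (ofT I 0 M n (Abelian.Ext.mk₀ f)) = f.hom (1 : R ⧸ I ^ n) := by
  rw [ev, liftT_of, evn_mk]

lemma exists_mk {M : ModuleCat.{u} R} (t : T I 0 M) :
    ∃ n, ∃ f : Xq I n ⟶ M, ofT I 0 M n (Abelian.Ext.mk₀ f) = t := by
  obtain ⟨n, x, rfl⟩ := exists_of I t
  obtain ⟨f, rfl⟩ := (Abelian.Ext.mk₀_bijective _ _).2 x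
  exact ⟨n, f, rfl⟩

lemma ev_nat {M N : ModuleCat.{u} R} (g : M ⟶ N) (t : T I 0 M) :
    ev I N (Tm I 0 g t) = g.hom (ev I M t) := by
  obtain ⟨n, f, rfl⟩ := exists_mk I t
  rw [Tm, post_of, Abelian.Ext.mk₀_comp_mk₀, ev_mk, ev_mk]
  rfl

lemma ev_inj {M : ModuleCat.{u} R} (t : T I 0 M) (h : ev I M t = 0) : t = 0 := by
  obtain ⟨n, f, rfl⟩ := exists_mk I t
  rw [ev_mk] at h
  have : f = 0 := by
    ext
    exact h
  rw [this]; simp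

lemma ev_tors {M : ModuleCat.{u} R} (t : T I 0 M) : ∃ n, ∀ r ∈ I ^ n, r • ev I M t = 0 := by
  obtain ⟨n, f, rfl⟩ := exists_mk I t
  refine ⟨n, fun r hr => ?_⟩
  rw [ev_mk, ← map_smul]
  have : r • (1 : R ⧸ I ^ n) = 0 := by
    rw [Algebra.smul_def, mul_one]
    exact Ideal.Quotient.eq_zero_iff_mem.2 hr
  rw [this, map_zero]

lemma ev_surj {M : ModuleCat.{u} R} (m : M) (n : ℕ) (h : ∀ r ∈ I ^ n, r • m = 0) :
    ∃ t, ev I M t = m := by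
  refine ⟨ofT I 0 M n (Abelian.Ext.mk₀ (ModuleCat.ofHom
    (Submodule.liftQ (I ^ n) (LinearMap.toSpanSingleton R M m) (fun r hr => h r hr)))), ?_⟩
  rw [ev_mk]
  change Submodule.liftQ (I ^ n) (LinearMap.toSpanSingleton R M m) _ (Submodule.Quotient.mk 1) = m
  exact (Submodule.liftQ_apply (I ^ n) _ 1).trans (one_smul R m)

/-- torsion submodule -/
def Gam (M : Type u) [AddCommGroup M] [Module R M] : Submodule R M where
  carrier := {m | ∃ n, ∀ r ∈ I ^ n, r • m = 0}
  zero_mem' := ⟨0, by simp⟩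
  add_mem' := by
    rintro a b ⟨n, hn⟩ ⟨m, hm⟩
    refine ⟨n + m, fun r hr => ?_⟩
    rw [smul_add, hn r (Ideal.pow_le_pow_right (by omega) hr),
      hm r (Ideal.pow_le_pow_right (by omega) hr), add_zero]
  smul_mem' := by
    rintro c a ⟨n, hn⟩
    exact ⟨n, fun r hr => by rw [smul_comm, hn r hr, smul_zero]⟩

lemma mem_Gam {M : Type u} [AddCommGroup M] [Module R M] (m : M) :
    m ∈ Gam I M ↔ ∃ n, ∀ r ∈ I ^ n, r • m = 0 := Iff.rfl

/-- a finitely generated torsion module is killed by a power -/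
lemma fg_kill {M N : Type u} [AddCommGroup M] [Module R M] [AddCommGroup N] [Module R N]
    [Module.Finite R N] (f : N →ₗ[R] Gam I M) : ∃ n, ∀ r ∈ I ^ n, ∀ x, r • f x = 0 := by
  obtain ⟨s, hs⟩ := (Module.Finite.fg_top : (⊤ : Submodule R N).FG)
  choose e he using fun x => (f x).2
  refine ⟨s.sup e, fun r hr x => ?_⟩
  have : x ∈ Submodule.span R (s : Set N) := by rw [hs]; trivial
  induction this using Submodule.span_induction with
  | mem x h =>
    ext
    exact he x r (Ideal.pow_le_pow_right (Finset.le_sup (f := e) h) hr)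
  | zero => simp
  | add x y _ _ hx hy => rw [map_add, smul_add, hx, hy, add_zero]
  | smul a x _ hx => rw [map_smul, smul_comm, hx, smul_zero]

lemma Gam_baer [IsNoetherianRing R] (E : Type u) [AddCommGroup E] [Module R E]
    (hE : Module.Injective R E) : Module.Baer R (Gam I E) := by
  intro J f
  obtain ⟨n, hn⟩ := fg_kill I f
  obtain ⟨k, hk⟩ := Ideal.exists_pow_inf_eq_pow_smul I (N := (J : Submodule R R))
  have h1 := hk (n + k) (by omega)
  have key : ∀ (y : R) (hy : y ∈ J), y ∈ I ^ (n + k) → f ⟨y, hy⟩ = 0 := by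
    intro y hy hyI
    have h2 : y ∈ (I ^ (n + k) • (⊤ : Submodule R R)) ⊓ J := ⟨by simpa using hyI, hy⟩
    rw [h1, Nat.add_sub_cancel] at h2
    have h3 : y ∈ I ^ n • (J : Submodule R R) := (Submodule.smul_mono le_rfl inf_le_right : I ^ n • (I ^ k • (⊤ : Submodule R R) ⊓ J) ≤ I ^ n • (J : Submodule R R)) h2
    have h4 : ∃ hy' : y ∈ J, f ⟨y, hy'⟩ = 0 := by
      refine Submodule.smul_induction_on (p := fun y => ∃ hy' : y ∈ J, f ⟨y, hy'⟩ = 0) h3 ?_ ?_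
      · intro r hr m hm
        refine ⟨J.smul_mem r hm, ?_⟩
        have := hn r hr ⟨m, hm⟩
        rw [← map_smul] at this
        exact this
      · rintro a b ⟨ha, ha'⟩ ⟨hb, hb'⟩
        refine ⟨J.add_mem ha hb, ?_⟩
        have := map_add f ⟨a, ha⟩ ⟨b, hb⟩
        rw [ha', hb', add_zero] at this
        exact this
    exact h4.2
  -- the map J → E ; J / (I^N ∩ J) → R / I^N
  let g : J →ₗ[R] (R ⧸ I ^ (n + k)) := (Submodule.mkQ (I ^ (n+k))) ∘ₗ J.subtype
  have hker : LinearMap.ker g ≤ LinearMap.ker f := by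
    intro y hy
    have hy' : (y : R) ∈ I ^ (n + k) := by
      exact (Submodule.Quotient.mk_eq_zero _).1 hy
    exact key y y.2 hy'
  let gb := (LinearMap.ker g).liftQ g le_rfl
  have hgb : Function.Injective gb := by
    rw [← LinearMap.ker_eq_bot]
    exact Submodule.ker_liftQ_eq_bot _ _ _ le_rfl
  let fb := (Gam I E).subtype ∘ₗ (LinearMap.ker g).liftQ f hker
  obtain ⟨h, hh⟩ := Module.Injective.out (self := hE) gb hgb fb
  refine ⟨LinearMap.toSpanSingleton R _ ⟨h (Submodule.Quotient.mk 1), n + k, fun r hr => ?_⟩, ?_⟩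
  · rw [← map_smul, ← Submodule.Quotient.mk_smul]
    have : (Submodule.Quotient.mk (r • (1:R)) : R ⧸ I ^ (n+k)) = 0 := by
      rw [Submodule.Quotient.mk_eq_zero]; simpa using hr
    rw [this, map_zero]
  · intro x hx
    have := hh (Submodule.Quotient.mk ⟨x, hx⟩)
    ext
    simp only [LinearMap.toSpanSingleton_apply]
    rw [Submodule.coe_smul, ← map_smul, ← Submodule.Quotient.mk_smul]
    simpa [gb, fb, g] using! this

lemma T_Gam [IsNoetherianRing R] (E : Type u) [AddCommGroup E] [Module R E]
    (hE : Module.Injective R E) (i : ℕ) (t : T I (i+1) (ModuleCat.of R (Gam I E))) : t = 0 := by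
  have := Module.Baer.injective (Gam_baer I E hE)
  have := Module.injective_object_of_injective_module R (Gam I E)
  exact T_inj I i _ t

lemma ses {A B C : Type u} [AddCommGroup A] [Module R A] [AddCommGroup B] [Module R B]
    [AddCommGroup C] [Module R C] (f : A →ₗ[R] B) (g : B →ₗ[R] C)
    (hf : Function.Injective f) (hg : Function.Surjective g) (h : ∀ b, g b = 0 ↔ ∃ a, f a = b) :
    ∃ w, (ShortComplex.mk (ModuleCat.ofHom f) (ModuleCat.ofHom g) w).ShortExact := by
  refine ⟨?_, ModuleCat.shortComplex_shortExact _ ?_ ?_ ?_⟩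
  · ext a
    exact (h (f a)).2 ⟨a, rfl⟩
  · exact fun b => h b
  · exact hf
  · exact hg

lemma tors_emb [IsNoetherianRing R] (U : Type u) [AddCommGroup U] [Module R U]
    (hU : ∀ u : U, u ∈ Gam I U) : ∃ (E : Type u) (_ : AddCommGroup E) (_ : Module R E)
    (_ : Module.Injective R E) (f : U →ₗ[R] Gam I E), Function.Injective f := by
  let X := ModuleCat.of R U
  let E := Injective.under X
  have hE : Injective E := inferInstance
  have h1 : Module.Injective R E := (Module.injective_iff_injective_object R E).2 hE
  refine ⟨E, inferInstance, inferInstance, h1, LinearMap.codRestrict _ (Injective.ι X).hom ?_, ?_⟩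
  · intro u
    obtain ⟨n, hn⟩ := hU u
    refine ⟨n, fun r hr => ?_⟩
    rw [← map_smul]
    erw [hn r hr]
    rw [map_zero]
  · have := (ModuleCat.mono_iff_injective (Injective.ι X)).1 inferInstance
    intro a b h
    apply this
    exact congrArg Subtype.val h

lemma T_tors [IsNoetherianRing R] (i : ℕ) : ∀ (U : Type u) [AddCommGroup U] [Module R U]
    (_ : ∀ u : U, u ∈ Gam I U) (t : T I (i+1) (ModuleCat.of R U)), t = 0 := by
  induction i with
  | zero =>
    intro U _ _ hU t
    obtain ⟨E, _, _, hE, f, hf⟩ := tors_emb I U hU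
    obtain ⟨w, hS⟩ := ses f (LinearMap.range f).mkQ hf (Submodule.mkQ_surjective _) (by
      intro b
      rw [Submodule.mkQ_apply, Submodule.Quotient.mk_eq_zero]; rfl)
    obtain ⟨s, rfl⟩ := exact1 I hS 0 t (T_Gam I E hE 0 _)
    obtain ⟨g, hg⟩ := Submodule.mkQ_surjective (LinearMap.range f) (ev I _ s)
    obtain ⟨n, hn⟩ := g.2
    obtain ⟨s', hs'⟩ := ev_surj I (M := ModuleCat.of R (Gam I E)) g n
      (fun r hr => by ext; exact hn r hr)
    have : Tm I 0 (ModuleCat.ofHom (LinearMap.range f).mkQ) s' = s := by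
      rw [← sub_eq_zero]
      apply ev_inj
      rw [map_sub, ev_nat, hs', sub_eq_zero]
      exact hg
    rw [← this]
    exact dl_comp I hS 0 s'
  | succ i ih =>
    intro U _ _ hU t
    obtain ⟨E, _, _, hE, f, hf⟩ := tors_emb I U hU
    obtain ⟨w, hS⟩ := ses f (LinearMap.range f).mkQ hf (Submodule.mkQ_surjective _) (by
      intro b
      rw [Submodule.mkQ_apply, Submodule.Quotient.mk_eq_zero]; rfl)
    obtain ⟨s, rfl⟩ := exact1 I hS (i+1) t (T_Gam I E hE (i+1) _)
    have : s = 0 := by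
      refine ih _ ?_ s
      intro c
      obtain ⟨g, rfl⟩ := Submodule.mkQ_surjective (LinearMap.range f) c
      obtain ⟨n, hn⟩ := g.2
      refine ⟨n, fun r hr => ?_⟩
      rw [← map_smul]
      have : r • g = 0 := by ext; exact hn r hr
      rw [this, map_zero]
    rw [this, map_zero]
end
end LCH
end

section
open CategoryTheory
namespace LCH
noncomputable section
variable {R : Type u} [CommRing R] (I : Ideal R)

lemma sec_lemma {C Z B : Type u} [AddCommGroup C] [Module R C] [AddCommGroup Z] [Module R Z]
    [AddCommGroup B] [Module R B] (f : C →ₗ[R] Z) (g : C →ₗ[R] B)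
    (hk : ∀ c, f c = 0 → g c = 0) (K : Submodule R Z) (hK : ∀ z ∈ K, ∃ c, f c = z) :
    ∃ s : K →ₗ[R] B, ∀ c (h : f c ∈ K), s ⟨f c, h⟩ = g c := by
  have hK' : K ≤ LinearMap.range f := fun z hz => hK z hz
  refine ⟨((LinearMap.ker f).liftQ g (fun c hc => hk c hc)) ∘ₗ
    f.quotKerEquivRange.symm.toLinearMap ∘ₗ Submodule.inclusion hK', ?_⟩
  intro c h
  have : Submodule.inclusion hK' ⟨f c, h⟩ = f.quotKerEquivRange (Submodule.Quotient.mk c) := by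
    ext; simp
  rw [LinearMap.comp_apply, LinearMap.comp_apply, this]
  exact (congrArg _ (LinearEquiv.symm_apply_apply f.quotKerEquivRange _)).trans
    (Submodule.liftQ_apply _ g c)

def tb (J : Ideal R) (Z : Type u) [AddCommGroup Z] [Module R Z] : Submodule R Z where
  carrier := {z | ∀ r ∈ J, r • z = 0}
  zero_mem' := by simp
  add_mem' := by
    intro a b ha hb r hr
    rw [smul_add, ha r hr, hb r hr, add_zero]
  smul_mem' := by
    intro c a ha r hr
    rw [smul_comm, ha r hr, smul_zero]

lemma hom_mem_tb (J : Ideal R) {Z : Type u} [AddCommGroup Z] [Module R Z] (g : (R ⧸ J) →ₗ[R] Z)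
    (a : R ⧸ J) : g a ∈ tb J Z := by
  intro r hr
  rw [← map_smul]
  obtain ⟨a, rfl⟩ := Ideal.Quotient.mk_surjective a
  have : r • (Ideal.Quotient.mk J a) = 0 := by
    rw [Algebra.smul_def]
    change Ideal.Quotient.mk J r * _ = 0
    rw [Ideal.Quotient.eq_zero_iff_mem.2 hr, zero_mul]
  rw [this, map_zero]

lemma hom_split (J : Ideal R) {P E Z : Type u} [AddCommGroup P] [Module R P] [AddCommGroup Z]
    [Module R Z] [AddCommGroup E] [Module R E] (u : P →ₗ[R] E) (v : E →ₗ[R] Z)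
    (hu : ∀ p, u p = 0 → p = 0) (hvu : ∀ p, v (u p) = 0) (hex : ∀ e, v e = 0 → ∃ p, u p = e)
    (s : tb J Z →ₗ[R] E) (hs : ∀ z, v (s z) = z) :
    Nonempty (((R ⧸ J) →ₗ[R] E) ≃ₗ[R] (((R ⧸ J) →ₗ[R] P) × ((R ⧸ J) →ₗ[R] Z))) := by
  let S : ((R ⧸ J) →ₗ[R] Z) →ₗ[R] ((R ⧸ J) →ₗ[R] E) :=
    { toFun := fun g => s ∘ₗ LinearMap.codRestrict (tb J Z) g (hom_mem_tb J g)
      map_add' := by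
        intro a b
        refine LinearMap.ext fun x => ?_
        exact map_add s ⟨a x, hom_mem_tb J a x⟩ ⟨b x, hom_mem_tb J b x⟩
      map_smul' := by
        intro a b
        refine LinearMap.ext fun x => ?_
        exact map_smul s a ⟨b x, hom_mem_tb J b x⟩ }
  have hS : ∀ g x, v (S g x) = g x := fun g x => hs _
  have huinj : Function.Injective u := by
    rw [← LinearMap.ker_eq_bot, LinearMap.ker_eq_bot']
    exact hu
  let F : (((R ⧸ J) →ₗ[R] P) × ((R ⧸ J) →ₗ[R] Z)) →ₗ[R] ((R ⧸ J) →ₗ[R] E) :=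
    LinearMap.coprod (LinearMap.llcomp R _ _ _ u) S
  have hF : ∀ f g x, F (f, g) x = u (f x) + S g x := by
    intro f g x
    simp [F]
  refine ⟨(LinearEquiv.ofBijective F ⟨?_, ?_⟩).symm⟩
  · rw [← LinearMap.ker_eq_bot, LinearMap.ker_eq_bot']
    rintro ⟨f, g⟩ h
    have h1 : ∀ x, u (f x) + S g x = 0 := fun x => by rw [← hF, h]; rfl
    have hg : g = 0 := by
      refine LinearMap.ext fun x => ?_
      have := congrArg v (h1 x)
      rw [map_add, hvu, hS, map_zero, zero_add] at this
      simpa using this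
    subst hg
    have hf : f = 0 := by
      refine LinearMap.ext fun x => ?_
      have := h1 x
      rw [map_zero, LinearMap.zero_apply, add_zero] at this
      exact hu _ this
    rw [hf]; rfl
  · intro h
    have hr : ∀ x, (h - S (v ∘ₗ h)) x ∈ LinearMap.range u := by
      intro x
      obtain ⟨p, hp⟩ := hex ((h - S (v ∘ₗ h)) x) (by
        rw [LinearMap.sub_apply, map_sub, hS, LinearMap.comp_apply, sub_self])
      exact ⟨p, hp⟩
    refine ⟨((LinearEquiv.ofInjective u huinj).symm.toLinearMap ∘ₗ
      LinearMap.codRestrict _ (h - S (v ∘ₗ h)) hr, v ∘ₗ h), ?_⟩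
    apply LinearMap.ext
    intro x
    rw [hF]
    have : u ((LinearEquiv.ofInjective u huinj).symm
        (LinearMap.codRestrict _ (h - S (v ∘ₗ h)) hr x)) = (h - S (v ∘ₗ h)) x := by
      have := congrArg Subtype.val (LinearEquiv.apply_symm_apply (LinearEquiv.ofInjective u huinj)
        (LinearMap.codRestrict _ (h - S (v ∘ₗ h)) hr x))
      exact this
    simp only [LinearMap.comp_apply, LinearEquiv.coe_coe]
    rw [this]
    simp
end
end LCH
end

section
open CategoryTheory
namespace LCH
noncomputable section
variable {R : Type u} [CommRing R] (I : Ideal R)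

lemma fac [IsNoetherianRing R] (n₀ : ℕ) (x : R) (hx : x ∈ I ^ (2 * n₀)) :
    ∃ (r : ℕ) (a b : Fin r → R), (∀ l, a l ∈ I ^ n₀) ∧ (Ideal.span (Set.range b) = I ^ n₀) ∧
      x = ∑ l, a l * b l := by
  obtain ⟨r, b, hb⟩ := Submodule.fg_iff_exists_fin_generating_family.1
    (IsNoetherian.noetherian (I ^ n₀))
  have h : x ∈ I ^ n₀ • Submodule.span R (Set.range b) := by
    rw [hb, smul_eq_mul, ← pow_add, ← two_mul]; exact hx
  obtain ⟨a, ha, rfl⟩ := (Submodule.mem_ideal_smul_span_iff_exists_sum _ _ _).1 h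
  exact ⟨r, a, b, ha, hb, by simp [Finsupp.sum_fintype]⟩

lemma quot_iso [IsNoetherianRing R] (A : Type u) [AddCommGroup A] [Module R A] (i : ℕ) :
    Function.Bijective (Tm I (i+1) (ModuleCat.ofHom (Gam I A).mkQ)) := by
  obtain ⟨w, hS⟩ := ses (Gam I A).subtype (Gam I A).mkQ (Submodule.subtype_injective _)
    (Submodule.mkQ_surjective _) (by
      intro b
      rw [Submodule.mkQ_apply, Submodule.Quotient.mk_eq_zero]
      exact ⟨fun h => ⟨⟨b, h⟩, rfl⟩, by rintro ⟨a, rfl⟩; exact a.2⟩)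
  have hU : ∀ u : Gam I A, u ∈ Gam I (Gam I A) := by
    rintro ⟨u, n, hn⟩
    exact ⟨n, fun r hr => by ext; exact hn r hr⟩
  constructor
  · rw [← LinearMap.ker_eq_bot, LinearMap.ker_eq_bot']
    intro t ht
    obtain ⟨s, hs⟩ := exact2 I hS (i+1) t ht
    rw [T_tors I i _ hU s, map_zero] at hs
    exact hs.symm
  · intro t
    exact exact3 I hS (i+1) t (T_tors I (i+1) _ hU _)

set_option maxHeartbeats 1600000 in
lemma core [IsNoetherianRing R] {A B : Type u} [AddCommGroup A] [Module R A] [AddCommGroup B]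
    [Module R B] (q : A →ₗ[R] B) (hq : Function.Surjective q) (x : R) (n₀ t : ℕ)
    (hx : x ∈ I ^ (2 * n₀)) (hq0 : ∀ a, q a = 0 ↔ ∃ a', a = x • a')
    (hfr : ∀ a : A, x • a = 0 → ∃ n, ∀ r ∈ I ^ n, r • a = 0) (ht : 0 < t)
    (hann : ∀ i < t, ∀ s : T I i (ModuleCat.of R A), ∀ r ∈ I ^ n₀, r • s = 0)
    (i : ℕ) (hi : i < t) :
    ∃ v : T I i (ModuleCat.of R B) →ₗ[R] T I (i+1) (ModuleCat.of R A),
      (∀ p, Tm I i (ModuleCat.ofHom q) p = 0 → p = 0) ∧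
      (∀ p, v (Tm I i (ModuleCat.ofHom q) p) = 0) ∧
      (∀ e, v e = 0 → ∃ p, Tm I i (ModuleCat.ofHom q) p = e) ∧
      ∃ s : tb (I ^ n₀) (T I (i+1) (ModuleCat.of R A)) →ₗ[R] T I i (ModuleCat.of R B),
        ∀ z, v (s z) = z := by
  obtain ⟨r, a, b, ha, hb, hxab⟩ := fac I n₀ x hx
  have hU1 : ∀ y ∈ Gam I A, ∀ r ∈ I ^ n₀, r • y = 0 := by
    rintro y ⟨n, hn⟩ r hr
    obtain ⟨s, hs⟩ := ev_surj I (M := ModuleCat.of R A) y n hn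
    have := hann 0 ht s r hr
    rw [← hs, ← map_smul, this, map_zero]
  have hbm : ∀ l, b l ∈ I ^ n₀ := fun l => hb ▸ Ideal.subset_span ⟨l, rfl⟩
  have hx1 : x ∈ I ^ n₀ := Ideal.pow_le_pow_right (by omega) hx
  let xb : (A ⧸ Gam I A) →ₗ[R] A := (Gam I A).liftQ (x • LinearMap.id) (fun y hy => LinearMap.mem_ker.2 (hU1 y hy x hx1))
  have hxb : ∀ y, xb ((Gam I A).mkQ y) = x • y := fun y => Submodule.liftQ_apply _ _ _
  have hxbi : Function.Injective xb := by
    rw [← LinearMap.ker_eq_bot, LinearMap.ker_eq_bot']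
    intro y hy
    obtain ⟨y, rfl⟩ := Submodule.mkQ_surjective _ y
    rw [hxb] at hy
    rw [Submodule.mkQ_apply, Submodule.Quotient.mk_eq_zero]
    exact hfr y hy
  let φ : (A ⧸ Gam I A) →ₗ[R] (Fin r → A) :=
    (Gam I A).liftQ (LinearMap.pi fun l => b l • LinearMap.id)
      (fun y hy => by ext l; exact hU1 y hy (b l) (hbm l))
  have hφ : ∀ y l, φ ((Gam I A).mkQ y) l = b l • y := fun y l => rfl
  have hφi : Function.Injective φ := by
    rw [← LinearMap.ker_eq_bot, LinearMap.ker_eq_bot']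
    intro y hy
    obtain ⟨y, rfl⟩ := Submodule.mkQ_surjective _ y
    rw [Submodule.mkQ_apply, Submodule.Quotient.mk_eq_zero]
    refine ⟨n₀, fun c hc => ?_⟩
    rw [← hb] at hc
    induction hc using Submodule.span_induction with
    | mem z hz =>
      obtain ⟨l, rfl⟩ := hz
      rw [← hφ, hy]; rfl
    | zero => simp
    | add z w _ _ hz hw => rw [add_smul, hz, hw, add_zero]
    | smul d z _ hz => rw [smul_assoc, hz, smul_zero]
  let α : (Fin r → A) →ₗ[R] A := ∑ l, a l • LinearMap.proj l
  have hαφ : ∀ y, α (φ y) = xb y := by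
    intro y
    obtain ⟨y, rfl⟩ := Submodule.mkQ_surjective _ y
    rw [hxb]
    simp only [α, LinearMap.sum_apply, LinearMap.smul_apply, LinearMap.proj_apply, hφ]
    rw [hxab, Finset.sum_smul]
    simp only [mul_smul]
  have hqx : ∀ y, q (xb y) = 0 := by
    intro y
    obtain ⟨y, rfl⟩ := Submodule.mkQ_surjective _ y
    rw [hxb]
    exact (hq0 _).2 ⟨y, rfl⟩
  let αb : ((Fin r → A) ⧸ LinearMap.range φ) →ₗ[R] B :=
    (LinearMap.range φ).liftQ (q ∘ₗ α) (by
      rintro _ ⟨y, rfl⟩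
      change q (α (φ y)) = 0
      rw [hαφ, hqx])
  obtain ⟨w2, hS2⟩ := ses xb q hxbi hq (by
    intro y
    rw [hq0]
    constructor
    · rintro ⟨y, rfl⟩
      exact ⟨(Gam I A).mkQ y, hxb y⟩
    · rintro ⟨y', rfl⟩
      obtain ⟨y, rfl⟩ := Submodule.mkQ_surjective _ y'
      exact ⟨y, hxb y⟩)
  obtain ⟨w3, hS3⟩ := ses φ (LinearMap.range φ).mkQ hφi (Submodule.mkQ_surjective _) (by
      intro b
      rw [Submodule.mkQ_apply, Submodule.Quotient.mk_eq_zero]; rfl)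
  have hα0 : ∀ y, Tm I i (ModuleCat.ofHom α) y = 0 := by
    intro y
    have : ModuleCat.ofHom α = ∑ l, a l • (ModuleCat.ofHom (LinearMap.proj l) :
        ModuleCat.of R (Fin r → A) ⟶ ModuleCat.of R A) := by
      apply ModuleCat.hom_ext
      simp [α, ModuleCat.hom_sum]
    rw [this, Tm_sum]
    refine Finset.sum_eq_zero fun l _ => ?_
    rw [Tm_smul]
    exact hann i hi _ _ (ha l)
  have hx0 : ∀ y, Tm I i (ModuleCat.ofHom xb) y = 0 := by
    intro y
    have : ModuleCat.ofHom xb = ModuleCat.ofHom φ ≫ ModuleCat.ofHom α := by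
      apply ModuleCat.hom_ext
      exact LinearMap.ext fun y => (hαφ y).symm
    rw [this, ← Tm_comp, hα0]
  let e := LinearEquiv.ofBijective _ (quot_iso I A i)
  have he : ∀ z, e z = Tm I (i+1) (ModuleCat.ofHom (Gam I A).mkQ) z := fun z => rfl
  refine ⟨e.symm.toLinearMap ∘ₗ dl I hS2 i, ?_, ?_, ?_, ?_⟩
  · intro p hp
    obtain ⟨s, rfl⟩ := exact2 I hS2 i p hp
    exact hx0 s
  · intro p
    have := dl_comp I hS2 i p
    change e.symm (dl I hS2 i _) = 0
    exact (congrArg _ this).trans (map_zero _)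
  · intro y hy
    have : dl I hS2 i y = 0 := by
      apply e.symm.injective
      rw [map_zero]; exact hy
    exact exact3 I hS2 i y this
  · let μ : ShortComplex.mk (ModuleCat.ofHom φ) (ModuleCat.ofHom (LinearMap.range φ).mkQ) w3 ⟶
        ShortComplex.mk (ModuleCat.ofHom xb) (ModuleCat.ofHom q) w2 :=
      { τ₁ := 𝟙 _
        τ₂ := ModuleCat.ofHom α
        τ₃ := ModuleCat.ofHom αb
        comm₁₂ := by
          apply ModuleCat.hom_ext
          exact LinearMap.ext fun y => (hαφ y).symm
        comm₂₃ := by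
          apply ModuleCat.hom_ext
          exact LinearMap.ext fun y => rfl }
    have hK : ∀ z ∈ tb (I ^ n₀) (T I (i+1) (ModuleCat.of R A)),
        ∃ c, (e.symm.toLinearMap ∘ₗ dl I hS3 i) c = z := by
      intro z hz
      have h1 : Tm I (i+1) (ModuleCat.ofHom φ) (e z) = 0 := by
        rw [he, Tm_comp]
        have : ModuleCat.ofHom (Gam I A).mkQ ≫ ModuleCat.ofHom φ =
            ∑ l, b l • (ModuleCat.ofHom (LinearMap.single R (fun _ : Fin r => A) l) :
            ModuleCat.of R A ⟶ ModuleCat.of R (Fin r → A)) := by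
          apply ModuleCat.hom_ext
          refine LinearMap.ext fun y => funext fun l => ?_
          refine (hφ y l).trans ?_
          simp [ModuleCat.hom_sum, Pi.single_apply]
        rw [this, Tm_sum]
        refine Finset.sum_eq_zero fun l _ => ?_
        rw [Tm_smul, ← map_smul, hz _ (hbm l), map_zero]
      obtain ⟨c, hc⟩ := exact1 I hS3 i _ h1
      refine ⟨c, ?_⟩
      change e.symm (dl I hS3 i c) = z
      rw [hc, LinearEquiv.symm_apply_apply]
    obtain ⟨s, hs⟩ := sec_lemma (e.symm.toLinearMap ∘ₗ dl I hS3 i)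
      (Tm I i (ModuleCat.ofHom αb)) (by
        intro c hc
        have : dl I hS3 i c = 0 := by
          apply e.symm.injective
          rw [map_zero]; exact hc
        obtain ⟨y, rfl⟩ := exact3 I hS3 i c this
        have h1 := Tm_comp I i (ModuleCat.ofHom (LinearMap.range φ).mkQ) (ModuleCat.ofHom αb) y
        have h2 : ModuleCat.ofHom (LinearMap.range φ).mkQ ≫ (ModuleCat.ofHom αb) =
          ModuleCat.ofHom α ≫ ModuleCat.ofHom q := (μ.comm₂₃).symm
        rw [h2, ← Tm_comp, hα0, map_zero] at h1
        exact h1) (tb (I ^ n₀) _) hK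
    refine ⟨s, ?_⟩
    rintro ⟨z, hz⟩
    obtain ⟨c, hc'⟩ := hK z hz
    subst hc'
    rw [hs]
    have h3 := dl_nat I hS3 hS2 μ i c
    have h4 : Tm I (i+1) μ.τ₁ (dl I hS3 i c) = dl I hS3 i c := Tm_id I (i+1) _
    rw [h4] at h3
    exact congrArg e.symm h3

lemma step1 [IsNoetherianRing R] {A B : Type u} [AddCommGroup A] [Module R A] [AddCommGroup B]
    [Module R B] (q : A →ₗ[R] B) (hq : Function.Surjective q) (x : R) (n₀ t : ℕ)
    (hx : x ∈ I ^ (2 * n₀)) (hq0 : ∀ a, q a = 0 ↔ ∃ a', a = x • a')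
    (hfr : ∀ a : A, x • a = 0 → ∃ n, ∀ r ∈ I ^ n, r • a = 0) (ht : 0 < t)
    (hann : ∀ i < t, ∀ s : T I i (ModuleCat.of R A), ∀ r ∈ I ^ n₀, r • s = 0)
    (i : ℕ) (hi : i < t) (k : ℕ) (hk : k ≤ n₀) :
    Nonempty (((R ⧸ I ^ k) →ₗ[R] T I i (ModuleCat.of R B)) ≃ₗ[R]
      (((R ⧸ I ^ k) →ₗ[R] T I i (ModuleCat.of R A)) ×
        ((R ⧸ I ^ k) →ₗ[R] T I (i+1) (ModuleCat.of R A)))) := by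
  obtain ⟨v, h1, h2, h3, s, hs⟩ := core I q hq x n₀ t hx hq0 hfr ht hann i hi
  have hle : tb (I ^ k) (T I (i+1) (ModuleCat.of R A)) ≤ tb (I ^ n₀) _ := by
    intro z hz r hr
    exact hz r (Ideal.pow_le_pow_right hk hr)
  exact hom_split (I ^ k) (Tm I i (ModuleCat.ofHom q)) v h1 h2 h3
    (s ∘ₗ Submodule.inclusion hle) (fun z => hs _)

lemma step2 [IsNoetherianRing R] {A B : Type u} [AddCommGroup A] [Module R A] [AddCommGroup B]
    [Module R B] (q : A →ₗ[R] B) (hq : Function.Surjective q) (x : R) (n₀ t : ℕ)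
    (hx : x ∈ I ^ (2 * n₀)) (hq0 : ∀ a, q a = 0 ↔ ∃ a', a = x • a')
    (hfr : ∀ a : A, x • a = 0 → ∃ n, ∀ r ∈ I ^ n, r • a = 0) (ht : 0 < t)
    (hann : ∀ i < t, ∀ s : T I i (ModuleCat.of R A), ∀ r ∈ I ^ n₀, r • s = 0)
    (i : ℕ) (hi : i + 1 < t) (z : T I i (ModuleCat.of R B)) (r : R) (hr : r ∈ I ^ n₀) :
    r • z = 0 := by
  obtain ⟨v, h1, h2, h3, s, hs⟩ := core I q hq x n₀ t hx hq0 hfr ht hann i (by omega)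
  let y : tb (I ^ n₀) (T I (i+1) (ModuleCat.of R A)) := ⟨v z, fun r hr => hann _ hi _ r hr⟩
  obtain ⟨p, hp⟩ := h3 (z - s y) (by rw [map_sub, hs, sub_self])
  have h5 : r • y = 0 := by
    ext
    exact hann _ hi _ r hr
  have h6 : z = Tm I i (ModuleCat.ofHom q) p + s y := by rw [hp, sub_add_cancel]
  rw [h6, smul_add, ← map_smul, ← map_smul, h5, hann i (by omega) p r hr, map_zero, map_zero,
    add_zero]
end
end LCH
end

section
open CategoryTheory
open scoped Pointwise
namespace LCH
noncomputable section
variable {R : Type u} [CommRing R] (I : Ideal R)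

section comb
variable (V : ℕ → Type u) [∀ l, AddCommGroup (V l)] [∀ l, Module R (V l)]

abbrev PPn (c a : ℕ → ℕ) : Type u := Π l, Fin (c l) → V (a l)

def pp_cons (c a : ℕ → ℕ) :
    PPn V c a ≃ₗ[R] (Fin (c 0) → V (a 0)) × PPn V (fun l => c (l+1)) (fun l => a (l+1)) where
  toFun f := (f 0, fun l => f (l+1))
  invFun p l := match l with
    | 0 => p.1
    | l+1 => p.2 l
  map_add' _ _ := rfl
  map_smul' _ _ := rfl
  left_inv f := by
    funext l
    cases l <;> rfl
  right_inv p := rfl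

def fin_add (W : Type u) [AddCommGroup W] [Module R W] (m n : ℕ) :
    (Fin (m + n) → W) ≃ₗ[R] (Fin m → W) × (Fin n → W) :=
  (LinearEquiv.funCongrLeft R W finSumFinEquiv).trans (LinearEquiv.sumArrowLequivProdArrow _ _ R W)

def pi_prod (A B : ℕ → Type u) [∀ l, AddCommGroup (A l)] [∀ l, Module R (A l)]
    [∀ l, AddCommGroup (B l)] [∀ l, Module R (B l)] :
    (Π l, A l × B l) ≃ₗ[R] (Π l, A l) × (Π l, B l) where
  toFun f := (fun l => (f l).1, fun l => (f l).2)
  invFun p l := (p.1 l, p.2 l)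
  map_add' _ _ := rfl
  map_smul' _ _ := rfl
  left_inv _ := rfl
  right_inv _ := rfl

def pp_add (c d a : ℕ → ℕ) :
    PPn V (fun l => c l + d l) a ≃ₗ[R] PPn V c a × PPn V d a :=
  (LinearEquiv.piCongrRight fun l => fin_add (R := R) (V (a l)) (c l) (d l)).trans (pi_prod _ _)

def pp_congr (c c' a a' : ℕ → ℕ) (h : c = c') (h' : a = a') : PPn V c a ≃ₗ[R] PPn V c' a' := by
  subst h h'
  exact LinearEquiv.refl R _

def fin_congr (W : Type u) [AddCommGroup W] [Module R W] {m n : ℕ} (h : m = n) :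
    (Fin m → W) ≃ₗ[R] (Fin n → W) := LinearEquiv.funCongrLeft R W (finCongr h.symm)

lemma pp_pascal (j i : ℕ) : Nonempty (PPn V (fun l => (j+1).choose l) (fun l => i + l) ≃ₗ[R]
    PPn V (fun l => j.choose l) (fun l => i + l) ×
      PPn V (fun l => j.choose l) (fun l => i + 1 + l)) := by
  let e1 := pp_cons (R := R) V (fun l => (j+1).choose l) (fun l => i + l)
  let e2 := pp_cons (R := R) V (fun l => j.choose l) (fun l => i + l)
  let e3 := pp_add (R := R) V (fun l => j.choose l) (fun l => j.choose (l+1)) (fun l => i + (l+1))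
  have h : (fun l => (j+1).choose (l+1)) = (fun l => j.choose l + j.choose (l+1)) :=
    funext fun l => Nat.choose_succ_succ _ _
  have h' : (fun l => i + (l + 1)) = fun l => i + 1 + l := funext fun l => by omega
  let e4 := pp_congr (R := R) V _ _ _ _ h (rfl : (fun l => i + (l + 1)) = fun l => i + (l + 1))
  let e5 := pp_congr (R := R) V _ _ _ _ (rfl : (fun l => j.choose l) = fun l => j.choose l) h'
  let e6 := fin_congr (R := R) (V (i + 0)) (show (j+1).choose 0 = j.choose 0 by simp)
  exact ⟨e1.trans ((e6.prodCongr (e4.trans (e3.trans (LinearEquiv.prodComm R _ _)))).trans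
    ((LinearEquiv.prodAssoc R _ _ _).symm.trans (e2.symm.prodCongr e5)))⟩

lemma pp_step (j i : ℕ) {X Y Z : Type u} [AddCommGroup X] [Module R X] [AddCommGroup Y] [Module R Y]
    [AddCommGroup Z] [Module R Z] (e : X ≃ₗ[R] Y × Z)
    (e1 : Y ≃ₗ[R] PPn V (fun l => j.choose l) (fun l => i + l))
    (e2 : Z ≃ₗ[R] PPn V (fun l => j.choose l) (fun l => i + 1 + l)) :
    Nonempty (X ≃ₗ[R] PPn V (fun l => (j+1).choose l) (fun l => i + l)) := by
  obtain ⟨δ⟩ := pp_pascal (R := R) V j i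
  exact ⟨e.trans ((e1.prodCongr e2).trans δ.symm)⟩

lemma pp_zero (i : ℕ) : Nonempty (PPn V (fun l => (0:ℕ).choose l) (fun l => i + l) ≃ₗ[R] V i) := by
  let e1 := pp_cons (R := R) V (fun l => (0:ℕ).choose l) (fun l => i + l)
  let e6 := fin_congr (R := R) (V (i + 0)) (show (0:ℕ).choose 0 = 1 by simp)
  have : Subsingleton (PPn V (fun l => (0:ℕ).choose (l+1)) (fun l => i + (l+1))) :=
    ⟨fun f g => funext fun l => funext fun y => (Fin.cast (Nat.choose_zero_succ l) y).elim0⟩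
  let e7 : PPn V (fun l => (0:ℕ).choose (l+1)) (fun l => i + (l+1)) ≃ₗ[R] PUnit.{u+1} :=
    LinearEquiv.ofBijective 0 ⟨fun _ _ _ => Subsingleton.elim _ _, fun _ => ⟨0, rfl⟩⟩
  exact ⟨e1.trans ((e6.prodCongr e7).trans
    ((LinearEquiv.prodUnique).trans (LinearEquiv.funUnique (Fin 1) R (V i))))⟩

lemma pp_fin (j : ℕ) : Nonempty (PPn V (fun l => j.choose l) (fun l => 0 + l) ≃ₗ[R]
    Π l : Fin (j+1), Fin (j.choose l) → V l) := by
  have h' : (fun l => 0 + l) = fun l => l := funext fun l => by omega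
  let e0 := pp_congr (R := R) V _ _ _ _ (rfl : (fun l => j.choose l) = fun l => j.choose l) h'
  suffices h : Nonempty (PPn V (fun l => j.choose l) (fun l => l) ≃ₗ[R]
      Π l : Fin (j+1), Fin (j.choose l) → V l) by
    obtain ⟨f⟩ := h
    exact ⟨e0.trans f⟩
  let F : PPn V (fun l => j.choose l) (fun l => l) →ₗ[R]
      Π l : Fin (j+1), Fin (j.choose l) → V l :=
    { toFun := fun f l => f l
      map_add' := fun _ _ => rfl
      map_smul' := fun _ _ => rfl }
  refine ⟨LinearEquiv.ofBijective F ⟨?_, ?_⟩⟩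
  · intro f g h
    funext l
    by_cases hl : l < j + 1
    · exact congrFun h ⟨l, hl⟩
    · have : j.choose l = 0 := Nat.choose_eq_zero_of_lt (by omega)
      funext y
      exact (Fin.cast this y).elim0
  · intro g
    refine ⟨fun l => if hl : l < j + 1 then g ⟨l, hl⟩ else 0, ?_⟩
    funext l
    exact dif_pos l.2
end comb

section ind
variable {M : Type u} [AddCommGroup M] [Module R M]

lemma factor_ker (N N' : Submodule R M) (x : R) (h : N' = N ⊔ x • (⊤ : Submodule R M))
    (hle : N ≤ N') (a : M ⧸ N) : Submodule.factor hle a = 0 ↔ ∃ a', a = x • a' := by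
  obtain ⟨m, rfl⟩ := Submodule.mkQ_surjective N a
  have : Submodule.factor hle (N.mkQ m) = N'.mkQ m := rfl
  rw [this, Submodule.mkQ_apply, Submodule.Quotient.mk_eq_zero, h, Submodule.mem_sup]
  constructor
  · rintro ⟨y, hy, z, hz, rfl⟩
    obtain ⟨w, -, rfl⟩ := (Submodule.mem_smul_pointwise_iff_exists _ _ _).1 hz
    refine ⟨N.mkQ w, ?_⟩
    rw [map_add, map_smul, Submodule.mkQ_apply N y, (Submodule.Quotient.mk_eq_zero N).2 hy, zero_add]
  · rintro ⟨a', ha⟩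
    obtain ⟨w, rfl⟩ := Submodule.mkQ_surjective N a'
    rw [← map_smul, ← sub_eq_zero, ← map_sub] at ha
    exact ⟨m - x • w, (Submodule.Quotient.mk_eq_zero N).1 ha, x • w,
      (Submodule.mem_smul_pointwise_iff_exists _ _ _).2 ⟨w, Submodule.mem_top, rfl⟩, by abel⟩

lemma N_succ {t : ℕ} (x : Fin t → R) (j : ℕ) (hj : j < t) :
    (Ideal.span (x '' {i | (i : ℕ) < j + 1}) • ⊤ : Submodule R M) =
      (Ideal.span (x '' {i | (i : ℕ) < j}) • ⊤ : Submodule R M) ⊔ x ⟨j, hj⟩ • ⊤ := by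
  have : {i : Fin t | (i : ℕ) < j + 1} = insert ⟨j, hj⟩ {i : Fin t | (i : ℕ) < j} := by
    ext i
    simp only [Set.mem_ofPred_eq, Set.mem_insert_iff, Fin.ext_iff]
    omega
  rw [this, Set.image_insert_eq, Ideal.span_insert, Submodule.sup_smul, sup_comm,
    Submodule.ideal_span_singleton_smul]

variable (M)

set_option maxHeartbeats 2000000 in
lemma main_ind [IsNoetherianRing R] (t n₀ : ℕ)
    (hann : ∀ i < t, ∀ s : T I i (ModuleCat.of R M), ∀ r ∈ I ^ n₀, r • s = 0)
    (x : Fin t → R)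
    (hfr : ∀ i : Fin t, ∀ m : M,
      x i • m ∈ (Ideal.span (x '' {j | j < i}) • ⊤ : Submodule R M) →
      ∃ n : ℕ, ∀ r ∈ I ^ n, r • m ∈ (Ideal.span (x '' {j | j < i}) • ⊤ : Submodule R M))
    (hx : ∀ i, x i ∈ I ^ (2 * n₀)) (k : ℕ) (hk : k ≤ n₀) (j : ℕ) (hj : j ≤ t) :
    (∀ i, i + j < t → ∀ s : T I i (ModuleCat.of R
        (M ⧸ (Ideal.span (x '' {i | (i : ℕ) < j}) • ⊤ : Submodule R M))),
      ∀ r ∈ I ^ n₀, r • s = 0) ∧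
    (∀ i, i + j ≤ t → Nonempty (((R ⧸ I ^ k) →ₗ[R] T I i (ModuleCat.of R
        (M ⧸ (Ideal.span (x '' {i | (i : ℕ) < j}) • ⊤ : Submodule R M)))) ≃ₗ[R]
      PPn (fun l => (R ⧸ I ^ k) →ₗ[R] T I l (ModuleCat.of R M)) (fun l => j.choose l)
        (fun l => i + l))) := by
  induction j with
  | zero =>
    have h0 : (Ideal.span (x '' {i | (i : ℕ) < 0}) • ⊤ : Submodule R M) = ⊥ := by simp
    rw [h0]
    let e := Submodule.quotEquivOfEqBot (⊥ : Submodule R M) rfl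
    have key : ∀ i, Nonempty (T I i (ModuleCat.of R (M ⧸ (⊥ : Submodule R M))) ≃ₗ[R]
        T I i (ModuleCat.of R M)) := by
      intro i
      refine ⟨LinearEquiv.ofLinearMap (Tm I i e.toModuleIso.hom) (Tm I i e.toModuleIso.inv) ?_ ?_⟩
      · refine LinearMap.ext fun z => ?_
        rw [LinearMap.comp_apply, Tm_comp, Iso.inv_hom_id, Tm_id]; rfl
      · refine LinearMap.ext fun z => ?_
        rw [LinearMap.comp_apply, Tm_comp, Iso.hom_inv_id, Tm_id]; rfl
    constructor
    · intro i hi s r hr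
      obtain ⟨ε⟩ := key i
      apply ε.injective
      rw [map_smul, map_zero]
      exact hann i hi _ r hr
    · intro i hi
      obtain ⟨ε⟩ := key i
      obtain ⟨δ⟩ := pp_zero (R := R) (fun l => (R ⧸ I ^ k) →ₗ[R] T I l (ModuleCat.of R M)) i
      exact ⟨(LinearEquiv.congrRight ε).trans δ.symm⟩
  | succ j ih =>
    obtain ⟨ih1, ih2⟩ := ih (by omega)
    have hs := N_succ (M := M) x j hj
    have hle : (Ideal.span (x '' {i | (i : ℕ) < j}) • ⊤ : Submodule R M) ≤
      (Ideal.span (x '' {i | (i : ℕ) < j + 1}) • ⊤ : Submodule R M) := by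
      rw [hs]; exact le_sup_left
    have hq0 := factor_ker _ _ _ hs hle
    have hfr' : ∀ a : M ⧸ (Ideal.span (x '' {i | (i : ℕ) < j}) • ⊤ : Submodule R M),
        x ⟨j, hj⟩ • a = 0 → ∃ n, ∀ r ∈ I ^ n, r • a = 0 := by
      intro a ha
      obtain ⟨m, rfl⟩ := Submodule.mkQ_surjective _ a
      rw [← map_smul, Submodule.mkQ_apply, Submodule.Quotient.mk_eq_zero] at ha
      obtain ⟨n, hn⟩ := hfr ⟨j, hj⟩ m ha
      refine ⟨n, fun r hr => ?_⟩
      rw [← map_smul, Submodule.mkQ_apply, Submodule.Quotient.mk_eq_zero]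
      exact hn r hr
    constructor
    · intro i hi s r hr
      exact step2 I (Submodule.factor hle) (Submodule.factor_surjective hle) (x ⟨j, hj⟩) n₀ (t - j)
        (hx _) hq0 hfr' (by omega) (fun i hi => ih1 i (by omega)) i (by omega) s r hr
    · intro i hi
      obtain ⟨e⟩ := step1 I (Submodule.factor hle) (Submodule.factor_surjective hle) (x ⟨j, hj⟩)
        n₀ (t - j)
        (hx _) hq0 hfr' (by omega) (fun i hi => ih1 i (by omega)) i (by omega) k hk
      obtain ⟨e1⟩ := ih2 i (by omega)
      obtain ⟨e2⟩ := ih2 (i+1) (by omega)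
      exact pp_step (R := R) (fun l => (R ⧸ I ^ k) →ₗ[R] T I l (ModuleCat.of R M)) j i e e1 e2

lemma hom_ev (k : ℕ) : Nonempty (((R ⧸ I ^ k) →ₗ[R] T I 0 (ModuleCat.of R M)) ≃ₗ[R]
    ((R ⧸ I ^ k) →ₗ[R] M)) := by
  have hinj : Function.Injective (ev I (ModuleCat.of R M)) := by
    rw [← LinearMap.ker_eq_bot, LinearMap.ker_eq_bot']
    exact ev_inj I
  refine ⟨LinearEquiv.ofBijective (LinearMap.llcomp R (R ⧸ I ^ k) _ _ (ev I (ModuleCat.of R M)))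
    ⟨?_, ?_⟩⟩
  · intro f g h
    refine LinearMap.ext fun y => hinj ?_
    exact congrArg (fun F : (R ⧸ I ^ k) →ₗ[R] M => F y) h
  · intro g
    have hr : ∀ y, g y ∈ LinearMap.range (ev I (ModuleCat.of R M)) := by
      intro y
      exact ev_surj I (M := ModuleCat.of R M) (g y) k (hom_mem_tb (I ^ k) g y)
    refine ⟨(LinearEquiv.ofInjective _ hinj).symm.toLinearMap ∘ₗ
      LinearMap.codRestrict _ g hr, ?_⟩
    refine LinearMap.ext fun y => ?_
    exact congrArg Subtype.val (LinearEquiv.apply_symm_apply (LinearEquiv.ofInjective _ hinj)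
        (LinearMap.codRestrict _ g hr y))

lemma main_T [IsNoetherianRing R] (t n₀ : ℕ)
    (hann : ∀ i < t, ∀ s : T I i (ModuleCat.of R M), ∀ r ∈ I ^ n₀, r • s = 0)
    (x : Fin t → R)
    (hfr : ∀ i : Fin t, ∀ m : M,
      x i • m ∈ (Ideal.span (x '' {j | j < i}) • ⊤ : Submodule R M) →
      ∃ n : ℕ, ∀ r ∈ I ^ n, r • m ∈ (Ideal.span (x '' {j | j < i}) • ⊤ : Submodule R M))
    (hx : ∀ i, x i ∈ I ^ (2 * n₀)) (k : ℕ) (hk : k ≤ n₀) (j : ℕ) (hj : j ≤ t) :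
    Nonempty (((R ⧸ I ^ k) →ₗ[R]
        (M ⧸ (Ideal.span (x '' {i | (i : ℕ) < j}) • ⊤ : Submodule R M))) ≃ₗ[R]
      Π l : Fin (j+1), Fin (j.choose l) → ((R ⧸ I ^ k) →ₗ[R] T I l (ModuleCat.of R M))) := by
  obtain ⟨e⟩ := (main_ind I M t n₀ hann x hfr hx k hk j hj).2 0 (by omega)
  obtain ⟨δ⟩ := pp_fin (R := R) (fun l => (R ⧸ I ^ k) →ₗ[R] T I l (ModuleCat.of R M)) j
  obtain ⟨ε⟩ := hom_ev I (M ⧸ (Ideal.span (x '' {i | (i : ℕ) < j}) • ⊤ : Submodule R M)) k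
  exact ⟨ε.symm.trans (e.trans δ)⟩
end ind
end
end LCH
end

section
open CategoryTheory Opposite
namespace LCH
noncomputable section
variable {R : Type u} [CommRing R]

section op
variable (K : ChainComplex (ModuleCat.{u} R)ᵒᵖ ℕ) (n : ℕ)

abbrev Oc : ModuleCat.{u} R := (K.opcycles n).unop
abbrev po : Oc K n ⟶ (K.X n).unop := (K.pOpcycles n).unop

lemma po_inj : Function.Injective (po K n) :=
  (ModuleCat.mono_iff_injective _).1 inferInstance

lemma po_exact (z : (K.X n).unop) (hz : (K.d (n+1) n).unop z = 0) : ∃ c, po K n c = z := by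
  have h := (ShortComplex.exact_of_g_is_cokernel (ShortComplex.mk (K.d (n+1) n) (K.pOpcycles n)
    (by simp)) (K.opcyclesIsCokernel (n+1) n (by simp))).unop
  exact (ShortComplex.moduleCat_exact_iff _).1 h z hz

lemma po_d (c : Oc K n) : (K.d (n+1) n).unop (po K n c) = 0 := by
  have h : po K n ≫ (K.d (n+1) n).unop = 0 := by
    rw [← unop_comp]; simp
  exact congrArg (fun f : Oc K n ⟶ _ => f c) h

abbrev ho : Oc K n ⟶ (K.homology n).unop := (K.homologyι n).unop

lemma ho_surj : Function.Surjective (ho K n) :=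
  (ModuleCat.epi_iff_surjective _).1 inferInstance

lemma ho_ker (c : Oc K n) : ho K n c = 0 ↔
    ∃ y : (K.X ((ComplexShape.down ℕ).next n)).unop, (K.d n _).unop y = po K n c := by
  have h := (ShortComplex.exact_of_f_is_kernel (ShortComplex.mk (K.homologyι n)
    (K.fromOpcycles n ((ComplexShape.down ℕ).next n))
    (by simp)) (K.homologyIsKernel n _ rfl)).unop
  have h2 : (K.fromOpcycles n ((ComplexShape.down ℕ).next n)).unop ≫ po K n = (K.d n _).unop := by
    rw [← unop_comp]; simp
  have h2' : ∀ y, po K n ((K.fromOpcycles n ((ComplexShape.down ℕ).next n)).unop y) =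
    (K.d n _).unop y := fun y => by rw [← h2]; rfl
  have h3 : (K.fromOpcycles n ((ComplexShape.down ℕ).next n)).unop ≫ ho K n = 0 := by
    rw [← unop_comp]; simp
  constructor
  · intro hc
    obtain ⟨y, hy⟩ := (ShortComplex.moduleCat_exact_iff _).1 h c hc
    refine ⟨y, ?_⟩
    exact (h2' y).symm.trans (congrArg _ hy)
  · rintro ⟨y, hy⟩
    rw [← h2'] at hy
    rw [← po_inj K n hy]
    exact congrArg (fun f : (K.X ((ComplexShape.down ℕ).next n)).unop ⟶ _ => f y) h3
end op

section ext
variable {X Y : ModuleCat.{u} R} (P : ProjectiveResolution X) (n : ℕ)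

lemma smul_extMk (f : P.complex.X n ⟶ Y) (m : ℕ) (hm : n + 1 = m)
    (hf : P.complex.d m n ≫ f = 0) (r : R) :
    r • P.extMk f m hm hf = P.extMk (r • f) m hm (by simp [hf]) := by
  rw [Abelian.Ext.smul_eq_comp_mk₀, P.extMk_comp_mk₀]
  congr 1

lemma extMk_zero_iff0 (f : P.complex.X 0 ⟶ Y) (m : ℕ) (hm : 0 + 1 = m)
    (hf : P.complex.d m 0 ≫ f = 0) : P.extMk f m hm hf = 0 ↔ f = 0 := by
  constructor
  · intro h
    simp only [← P.extEquivCohomologyClass.apply_eq_iff_eq,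
      ProjectiveResolution.extEquivCohomologyClass_extMk,
      ProjectiveResolution.extEquivCohomologyClass_zero,
      CochainComplex.HomComplex.CohomologyClass.mk_eq_zero_iff] at h
    rw [CochainComplex.HomComplex.Cocycle.toSingleMk_mem_coboundaries_iff _ _ _ _ _ 1 (by simp)] at h
    obtain ⟨g, hg⟩ := h
    have hz : Limits.IsZero (P.cochainComplex.X 1) := by
      exact CochainComplex.isZero_of_isStrictlyLE _ 0 _ (by simp)
    rw [hz.eq_of_src g 0, Limits.comp_zero] at hg
    rw [← cancel_epi (P.cochainComplexXIso (-0) 0 rfl).hom, Limits.comp_zero]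
    exact hg.symm
  · rintro rfl
    simp

lemma extMk_zero_iff (f : P.complex.X n ⟶ Y) (m : ℕ) (hm : n + 1 = m)
    (hf : P.complex.d m n ≫ f = 0) : P.extMk f m hm hf = 0 ↔
      ∃ g : P.complex.X ((ComplexShape.down ℕ).next n) ⟶ Y, P.complex.d n _ ≫ g = f := by
  cases n with
  | zero =>
    rw [extMk_zero_iff0]
    constructor
    · rintro rfl
      exact ⟨0, by simp⟩
    · rintro ⟨g, rfl⟩
      rw [P.complex.shape, Limits.zero_comp]
      simp
  | succ p =>
    have : (ComplexShape.down ℕ).next (p+1) = p := by simp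
    rw [this]
    exact P.extMk_eq_zero_iff f m hm hf p rfl

abbrev KP (Y : ModuleCat.{u} R) : ChainComplex (ModuleCat.{u} R)ᵒᵖ ℕ :=
  (((linearYoneda R (ModuleCat.{u} R)).obj Y).rightOp.mapHomologicalComplex _).obj P.complex

lemma KP_d (m : ℕ) (f : P.complex.X n ⟶ Y) :
    (((KP P Y).d m n).unop.hom f : P.complex.X m ⟶ Y) = P.complex.d m n ≫ f := rfl

def poc (c : Oc (KP P Y) n) : P.complex.X n ⟶ Y := po (KP P Y) n c

lemma poc_d (c : Oc (KP P Y) n) : P.complex.d (n+1) n ≫ poc P n c = 0 :=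
  po_d (KP P Y) n c

def psi : Oc (KP P Y) n →ₗ[R] Abelian.Ext X Y n where
  toFun c := P.extMk (poc P n c) (n+1) rfl (poc_d P n c)
  map_add' a b := by
    rw [P.add_extMk]
    congr 1
    exact map_add (po (KP P Y) n).hom a b
  map_smul' r a := by
    rw [RingHom.id_apply, smul_extMk]
    congr 1
    exact map_smul (po (KP P Y) n).hom r a

lemma psi_surj : Function.Surjective (psi (Y := Y) P n) := by
  intro x
  obtain ⟨f, hf, rfl⟩ := P.extMk_surjective x (n+1) rfl
  obtain ⟨c, hc⟩ := po_exact (KP P Y) n f hf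
  refine ⟨c, ?_⟩
  change P.extMk (poc P n c) (n+1) rfl (poc_d P n c) = _
  congr 1

abbrev OldE (n : ℕ) (X Y : ModuleCat.{u} R) : ModuleCat.{u} R :=
  ((Ext R (ModuleCat.{u} R) n).obj (op X)).obj Y

def rho : Oc (KP P Y) n ⟶ OldE n X Y :=
  ((P.isoLeftDerivedObj ((linearYoneda R (ModuleCat.{u} R)).obj Y).rightOp n).hom ≫
    (KP P Y).homologyι n).unop

lemma rho_eq (c : Oc (KP P Y) n) : rho P n c =
  (P.isoLeftDerivedObj ((linearYoneda R (ModuleCat.{u} R)).obj Y).rightOp n).hom.unop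
    (ho (KP P Y) n c) := rfl

lemma rho_surj : Function.Surjective (rho (Y := Y) P n) := by
  have : Function.Surjective (P.isoLeftDerivedObj
        ((linearYoneda R (ModuleCat.{u} R)).obj Y).rightOp n).hom.unop :=
      (ModuleCat.epi_iff_surjective _).1 inferInstance
  exact this.comp (ho_surj (KP P Y) n)

lemma rho_ker (c : Oc (KP P Y) n) : rho P n c = 0 ↔ psi P n c = 0 := by
  have h1 : rho P n c = 0 ↔ ho (KP P Y) n c = 0 := by
    rw [rho_eq]
    have : Function.Injective (P.isoLeftDerivedObj
        ((linearYoneda R (ModuleCat.{u} R)).obj Y).rightOp n).hom.unop :=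
      (ModuleCat.mono_iff_injective _).1 inferInstance
    constructor
    · intro h
      exact this (h.trans (map_zero _).symm)
    · intro h
      rw [h]; exact map_zero _
  rw [h1, ho_ker]
  exact (extMk_zero_iff P n (poc P n c) (n+1) rfl (poc_d P n c)).symm

def eE : OldE n X Y ≃ₗ[R] Abelian.Ext X Y n :=
  ((rho (Y := Y) P n).hom.quotKerEquivOfSurjective (rho_surj P n)).symm ≪≫ₗ
  (Submodule.quotEquivOfEq _ _ (by
    ext c
    rw [LinearMap.mem_ker, LinearMap.mem_ker]
    exact rho_ker P n c)) ≪≫ₗ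
  (psi (Y := Y) P n).quotKerEquivOfSurjective (psi_surj P n)

lemma eE_rho (c : Oc (KP P Y) n) : eE P n (rho P n c) = psi P n c := by
  have : rho P n c = (rho (Y := Y) P n).hom.quotKerEquivOfSurjective (rho_surj P n)
    (Submodule.Quotient.mk c) := rfl
  rw [this]
  simp only [eE, LinearEquiv.trans_apply, LinearEquiv.symm_apply_apply]
  rfl

variable {X' : ModuleCat.{u} R} (P' : ProjectiveResolution X') (g : X' ⟶ X)

lemma eE_nat (z : OldE n X Y) :
    eE P' n (((Ext R (ModuleCat.{u} R) n).map g.op).app Y z) =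
      (Abelian.Ext.mk₀ g).comp (eE P n z) (zero_add n) := by
  obtain ⟨c, rfl⟩ := rho_surj P n z
  let φ : P'.complex ⟶ P.complex := ProjectiveResolution.lift g P' P
  have hφ : φ.f 0 ≫ P.π.f 0 = P'.π.f 0 ≫ g :=
    ProjectiveResolution.lift_commutes_zero g P' P
  let F := ((linearYoneda R (ModuleCat.{u} R)).obj Y).rightOp
  let Φ : KP P' Y ⟶ KP P Y := (F.mapHomologicalComplex _).map φ
  let c' : Oc (KP P' Y) n := (HomologicalComplex.opcyclesMap Φ n).unop c
  have h1 : rho P' n c' = ((Ext R (ModuleCat.{u} R) n).map g.op).app Y (rho P n c) := by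
    have := ProjectiveResolution.isoLeftDerivedObj_hom_naturality g P' P φ hφ F n
    have h2 := HomologicalComplex.homologyι_naturality Φ n
    have h3 : ((F.leftDerived n).map g ≫ (P.isoLeftDerivedObj F n).hom ≫ (KP P Y).homologyι n) =
      ((P'.isoLeftDerivedObj F n).hom ≫ (KP P' Y).homologyι n) ≫
        HomologicalComplex.opcyclesMap Φ n :=
      (Category.assoc _ _ _).symm.trans
        ((congrArg (fun f => f ≫ (KP P Y).homologyι n) this).trans
          ((Category.assoc _ _ _).trans
            ((congrArg (fun f => (P'.isoLeftDerivedObj F n).hom ≫ f) h2).trans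
              (Category.assoc _ _ _).symm)))
    exact (congrArg (fun f => f.unop c) h3).symm
  have h4 : poc P' n c' = φ.f n ≫ poc P n c := by
    have := HomologicalComplex.p_opcyclesMap Φ n
    exact (congrArg (fun f => f.unop c) this)
  rw [← h1, eE_rho, eE_rho]
  change P'.extMk (poc P' n c') (n+1) rfl (poc_d P' n c') =
    (Abelian.Ext.mk₀ g).comp (P.extMk (poc P n c) (n+1) rfl (poc_d P n c)) _
  rw [ProjectiveResolution.mk₀_comp_extMk (φ := ⟨φ, hφ⟩)]
  congr 1
end ext

section colim
open Limits
variable (I : Ideal R) (i : ℕ) (M : ModuleCat.{u} R)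

abbrev Dg : ℕᵒᵖᵒᵖ ⥤ ModuleCat.{u} R :=
  localCohomology.diagram (localCohomology.idealPowersDiagram I) i ⋙ (evaluation _ _).obj M

lemma exists_cocone : ∃ (c : Cocone (Dg I i M)), Nonempty (IsColimit c) ∧
    c.pt = (localCohomology I i).obj M := by
  have := localCohomology.hasColimitDiagram (localCohomology.idealPowersDiagram I) i
  exact ⟨((evaluation _ _).obj M).mapCocone (colimit.cocone
    (localCohomology.diagram (localCohomology.idealPowersDiagram I) i)),
    ⟨isColimitOfPreserves _ (colimit.isColimit _)⟩, rfl⟩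

lemma Dg_map (n m : ℕ) (h : n ≤ m) :
    (Dg I i M).map (homOfLE h).op.op = ((Ext R (ModuleCat.{u} R) i).map (pq I h).op).app M := rfl

def eD (n : ℕ) : (Dg I i M).obj (op (op n)) ≃ₗ[R] Abelian.Ext (Xq I n) M i :=
  eE (projectiveResolution (Xq I n)) i

lemma eD_map (n m : ℕ) (h : n ≤ m) (z : (Dg I i M).obj (op (op n))) :
    eD I i M m ((Dg I i M).map (homOfLE h).op.op z) = tr I i M n m h (eD I i M n z) :=
  eE_nat _ _ _ _ z

lemma T_equiv : Nonempty (T I i M ≃ₗ[R] (localCohomology I i).obj M) := by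
  obtain ⟨c, ⟨hc⟩, hpt⟩ := exists_cocone I i M
  rw [← hpt]
  have : PreservesFilteredColimitsOfSize.{0, 0} (forget (ModuleCat.{u} R)) :=
    preservesFilteredColimitsOfSize_shrink.{0, u, 0, u} _
  have : IsFiltered ℕᵒᵖᵒᵖ := inferInstance
  have : PreservesColimit (Dg I i M) (forget (ModuleCat.{u} R)) :=
    (PreservesFilteredColimitsOfSize.preserves_filtered_colimits ℕᵒᵖᵒᵖ).preservesColimit
  let g : ∀ n, Abelian.Ext (Xq I n) M i →ₗ[R] c.pt := fun n =>
    (c.ι.app (op (op n))).hom ∘ₗ (eD I i M n).symm.toLinearMap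
  have hg : ∀ n m h x, g m (tr I i M n m h x) = g n x := by
    intro n m h x
    obtain ⟨z, rfl⟩ := (eD I i M n).surjective x
    rw [← eD_map]
    simp only [g, LinearMap.comp_apply, LinearEquiv.coe_coe, LinearEquiv.symm_apply_apply]
    have := c.w (homOfLE h).op.op
    exact congrArg (fun f => f.hom z) this
  refine ⟨LinearEquiv.ofBijective (liftT I g hg) ⟨?_, ?_⟩⟩
  · rw [injective_iff_map_eq_zero]
    intro s hs
    obtain ⟨n, x, rfl⟩ := exists_of I s
    rw [liftT_of] at hs
    obtain ⟨z, rfl⟩ := (eD I i M n).surjective x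
    simp only [g, LinearMap.comp_apply, LinearEquiv.coe_coe, LinearEquiv.symm_apply_apply] at hs
    obtain ⟨k, f, f', hf⟩ := (Concrete.isColimit_rep_eq_iff_exists (Dg I i M) hc
      (i := op (op n)) (j := op (op n)) z 0).1 (hs.trans (map_zero _).symm)
    have h : n ≤ k.unop.unop := leOfHom f.unop.unop
    have hfz : (Dg I i M).map (homOfLE h).op.op z = 0 := hf.trans (map_zero _)
    rw [← of_tr I h, ← eD_map, hfz, map_zero, map_zero]
  · intro y
    obtain ⟨j, z, rfl⟩ := Concrete.isColimit_exists_rep (Dg I i M) hc y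
    refine ⟨ofT I i M j.unop.unop (eD I i M j.unop.unop z), ?_⟩
    rw [liftT_of]
    simp only [g, LinearMap.comp_apply, LinearEquiv.coe_coe, LinearEquiv.symm_apply_apply]
end colim
end
end LCH
end

/-- under the standing hypotheses, for `1 ≤ k ≤ n₀` and `0 ≤ j ≤ t`,
`Hom_R(R/𝔪^k, M/(x_1,…,x_j)M) ≅ ⊕_{i=0}^{j} Hom_R(R/𝔪^k, H^i_𝔪(M))^{C(j,i)}`. -/
theorem hom_quotient_splitting
    {R : Type u} [CommRing R] [IsNoetherianRing R] [IsLocalRing R]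
    (M : Type u) [AddCommGroup M] [Module R M] [Module.Finite R M]
    (t n₀ : ℕ)
    (ht : sInf {i | ¬ Module.Finite R (lcoh (maximalIdeal R) i M)} = t) (ht0 : 0 < t)
    (hn₀ : 1 ≤ n₀)
    (hann : ∀ i < t, ∀ (a : lcoh (maximalIdeal R) i M),
      ∀ r ∈ maximalIdeal R ^ n₀, r • a = 0)
    (x : Fin t → R) (hfr : IsFilterRegularSeq (maximalIdeal R) M x)
    (hx : ∀ i, x i ∈ maximalIdeal R ^ (2 * n₀)) :
    ∀ k, 1 ≤ k → k ≤ n₀ → ∀ j ≤ t,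
      Nonempty (((R ⧸ (maximalIdeal R ^ k)) →ₗ[R]
          (M ⧸ (Ideal.span (x '' {i | (i : ℕ) < j}) • ⊤ : Submodule R M)))
        ≃ₗ[R] Π i : Fin (j + 1), Fin (j.choose i) →
          ((R ⧸ (maximalIdeal R ^ k)) →ₗ[R] lcoh (maximalIdeal R) i M)) := by
  intro k _ hk j hj
  have E : ∀ l, Nonempty (LCH.T (maximalIdeal R) l (ModuleCat.of R M) ≃ₗ[R]
      lcoh (maximalIdeal R) l M) := fun l => LCH.T_equiv (maximalIdeal R) l (ModuleCat.of R M)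
  have e := fun l => (E l).some
  have hann' : ∀ i < t, ∀ s : LCH.T (maximalIdeal R) i (ModuleCat.of R M),
      ∀ r ∈ maximalIdeal R ^ n₀, r • s = 0 := by
    intro i hi s r hr
    apply (e i).injective
    rw [map_smul, map_zero]
    exact hann i hi _ r hr
  obtain ⟨f⟩ := LCH.main_T (maximalIdeal R) M t n₀ hann' x hfr hx k hk j hj
  exact ⟨f ≪≫ₗ LinearEquiv.piCongrRight fun i => LinearEquiv.piCongrRight fun _ =>
    LinearEquiv.congrRight (e i)⟩
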